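/- For γ = [[a, 24b],[c/24, d]] arising from γ' = [[a,b],[c,d]] ∈ Γ₀(576) (so 24 | b is forced in the conjugated matrix, and 576 | c), the eta multiplier satisfies χ([[a, 24b],[c/24, d]]) = (12/d)·(c/d)·ε_d^{−1}, i.e., the conjugation of the eta multiplier by scaling by 24 equals the character (12/·) times the theta multiplier on Γ₀(576). -/

import Mathlib

/-- The Dedekind eta function `η(τ) = q^{1/24} Π_{n≥1} (1 - q^n)`, `q = e^{2πiτ}`. -/
noncomputable def eta (τ : ℂ) : ℂ :=
  Complex.exp (Real.pi * Complex.I * τ / 12) *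
    ∏' n : ℕ, (1 - Complex.exp (2 * Real.pi * Complex.I * ((n : ℂ) + 1) * τ))

/-- Extended Kronecker symbol `(c/d)` for odd `d`. -/
def kron (c d : ℤ) : ℤ :=
  (if d < 0 ∧ c < 0 then -1 else 1) * jacobiSym c d.natAbs

/-- `ε_d = 1` if `d ≡ 1 (mod 4)`, `ε_d = i` if `d ≡ 3 (mod 4)`. -/
noncomputable def epsd (d : ℤ) : ℂ := if d % 4 = 1 then 1 else Complex.I

/-- `E n = e(n/24)`. -/
noncomputable def EE (n : ℤ) : ℂ := Complex.exp (2 * Real.pi * Complex.I * n / 24)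

theorem EE_add (m n : ℤ) : EE (m + n) = EE m * EE n := by
  unfold EE; rw [← Complex.exp_add]; congr 1; push_cast; ring

theorem EE_zero : EE 0 = 1 := by simp [EE]

theorem EE_ne (n : ℤ) : EE n ≠ 0 := Complex.exp_ne_zero _

theorem EE_24 (n : ℤ) : EE (24 * n) = 1 := by
  unfold EE
  rw [Complex.exp_eq_one_iff]
  exact ⟨n, by push_cast; ring⟩

theorem EE_period {m n : ℤ} (k : ℤ) (h : m = n + 24 * k) : EE m = EE n := by
  rw [h, EE_add, EE_24, mul_one]

theorem EE_12 : EE 12 = -1 := by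
  unfold EE
  rw [← Complex.exp_pi_mul_I]; congr 1; push_cast; ring

theorem EE_12_mul (k : ℕ) : EE (12 * k) = (-1) ^ k := by
  induction k with
  | zero => simp [EE_zero]
  | succ k ih =>
    rw [show (12 * ((k + 1 : ℕ) : ℤ)) = 12 * k + 12 by push_cast; ring, EE_add, ih, EE_12, pow_succ]

theorem EE_6 : EE 6 = Complex.I := by
  unfold EE
  rw [show 2 * (Real.pi : ℂ) * Complex.I * ((6 : ℤ) : ℂ) / 24 = Real.pi / 2 * Complex.I by
    push_cast; ring, Complex.exp_pi_div_two_mul_I]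

theorem EE_3 : Complex.I ^ ((1 : ℂ) / 2) = EE 3 := by
  rw [Complex.cpow_def_of_ne_zero Complex.I_ne_zero, Complex.log_I]
  unfold EE; congr 1; push_cast; ring

theorem eta_ne (τ : ℂ) (h : 0 < τ.im) : eta τ ≠ 0 := by
  unfold eta
  refine mul_ne_zero (Complex.exp_ne_zero _) ?_
  have := ModularForm.eta_tprod_ne_zero (z := τ) h
  simpa only [ModularForm.eta_q_eq_cexp] using this

theorem eta_add (τ : ℂ) (n : ℤ) : eta (τ + n) = EE n * eta τ := by
  unfold eta EE
  rw [← mul_assoc, ← Complex.exp_add]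
  congr 1
  · congr 1; ring
  · congr 1; funext m
    congr 1
    rw [Complex.exp_eq_exp_iff_exists_int]
    exact ⟨(m + 1) * n, by push_cast; ring⟩

/-- Square root of `I * z` for `z` in the open first quadrant. -/
theorem sqrt_I_mul (z : ℂ) (h1 : 0 < z.re) (h2 : 0 < z.im) :
    (Complex.I * z) ^ ((1 : ℂ) / 2) = EE 3 * z ^ ((1 : ℂ) / 2) := by
  have hz : z ≠ 0 := by rintro rfl; simp at h1
  rw [← EE_3, Complex.cpow_def_of_ne_zero (mul_ne_zero Complex.I_ne_zero hz),
    Complex.cpow_def_of_ne_zero hz, Complex.cpow_def_of_ne_zero Complex.I_ne_zero, Complex.log_mul,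
    add_mul, Complex.exp_add]
  · exact Complex.I_ne_zero
  · exact hz
  · rw [Complex.arg_I]
    have := Complex.abs_arg_lt_pi_div_two_iff.2 (Or.inl h1 : 0 < z.re ∨ z = 0)
    rw [abs_lt] at this
    constructor <;> linarith [Real.pi_pos]

/-- The transformation hypothesis. -/
def IsMult (χ : Matrix (Fin 2) (Fin 2) ℤ → ℂ) : Prop :=
  ∀ a b c d : ℤ, a * d - b * c = 1 → ∀ τ : ℂ, 0 < τ.im →
      eta (((a : ℂ) * τ + (b : ℂ)) / ((c : ℂ) * τ + (d : ℂ))) =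
        χ !![a, b; c, d] * ((c : ℂ) * τ + (d : ℂ)) ^ ((1 : ℂ)/2) * eta τ

theorem sqrt_ne {z : ℂ} (h : z ≠ 0) : z ^ ((1 : ℂ) / 2) ≠ 0 := by
  rw [Complex.cpow_def_of_ne_zero h]; exact Complex.exp_ne_zero _

theorem lin_ne (c d : ℤ) (hc : 0 < c) (τ : ℂ) (h : 0 < τ.im) : (c : ℂ) * τ + d ≠ 0 := by
  intro h0
  have := congrArg Complex.im h0
  have hc' : (0 : ℝ) < c := by exact_mod_cast hc
  simp at this
  rcases this with h1 | h1
  · omega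
  · linarith

theorem step_T {χ : Matrix (Fin 2) (Fin 2) ℤ → ℂ} (hχ : IsMult χ) (a b c d n : ℤ)
    (h : a * d - b * c = 1) (hc : 0 < c) :
    χ !![a, b + n * a; c, d + n * c] = χ !![a, b; c, d] * EE n := by
  have him : 0 < (Complex.I + n).im := by simp
  have h1 := hχ a (b + n * a) c (d + n * c) (by linear_combination h) Complex.I (by simp)
  have h2 := hχ a b c d h (Complex.I + n) him
  have e1 : (a : ℂ) * Complex.I + ((b + n * a : ℤ) : ℂ) = a * (Complex.I + n) + b := by
    push_cast; ring
  have e2 : (c : ℂ) * Complex.I + ((d + n * c : ℤ) : ℂ) = c * (Complex.I + n) + d := by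
    push_cast; ring
  rw [e1, e2, h2, eta_add] at h1
  have n1 := sqrt_ne (lin_ne c d hc _ him)
  have n2 := eta_ne Complex.I (by simp)
  apply mul_right_cancel₀ n1
  apply mul_right_cancel₀ n2
  rw [← h1]; ring

theorem step_S_pos {χ : Matrix (Fin 2) (Fin 2) ℤ → ℂ} (hχ : IsMult χ) (a b c d : ℤ)
    (h : a * d - b * c = 1) (hc : 0 < c) (hd : 0 < d) :
    χ !![a, b; c, d] = χ !![b, -a; d, -c] * EE 3 := by
  have h1 := hχ a b c d h Complex.I (by simp)
  have h2 := hχ b (-a) d (-c) (by linear_combination h) Complex.I (by simp)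
  have e1 : (b : ℂ) * Complex.I + ((-a : ℤ) : ℂ) = Complex.I * (a * Complex.I + b) := by
    push_cast; linear_combination (-a : ℂ) * Complex.I_mul_I
  have e2 : (d : ℂ) * Complex.I + ((-c : ℤ) : ℂ) = Complex.I * (c * Complex.I + d) := by
    push_cast; linear_combination (-c : ℂ) * Complex.I_mul_I
  have hc' : (0 : ℝ) < c := by exact_mod_cast hc
  have hd' : (0 : ℝ) < d := by exact_mod_cast hd
  rw [e1, e2, mul_div_mul_left _ _ Complex.I_ne_zero, h1, sqrt_I_mul _ (by simpa) (by simpa)] at h2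
  have n1 := sqrt_ne (lin_ne c d hc Complex.I (by simp))
  have n2 := eta_ne Complex.I (by simp)
  apply mul_right_cancel₀ n1
  apply mul_right_cancel₀ n2
  rw [h2]; ring

theorem step_S_neg {χ : Matrix (Fin 2) (Fin 2) ℤ → ℂ} (hχ : IsMult χ) (a b c d : ℤ)
    (h : a * d - b * c = 1) (hc : 0 < c) (hd : d < 0) :
    χ !![a, b; c, d] * EE 3 = χ !![-b, a; -d, c] := by
  have h3 := step_S_pos hχ (-b) a (-d) c (by linear_combination h) (by omega) hc
  have h1 := hχ a b c d h Complex.I (by simp)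
  have h2 := hχ (-b) a (-d) c (by linear_combination h) Complex.I (by simp)
  have e1 : (a : ℂ) * Complex.I + b = Complex.I * (((-b : ℤ) : ℂ) * Complex.I + a) := by
    push_cast; linear_combination (b : ℂ) * Complex.I_mul_I
  have e2 : (c : ℂ) * Complex.I + d = Complex.I * (((-d : ℤ) : ℂ) * Complex.I + c) := by
    push_cast; linear_combination (d : ℂ) * Complex.I_mul_I
  have hc' : (0 : ℝ) < c := by exact_mod_cast hc
  have hd' : (d : ℝ) < 0 := by exact_mod_cast hd
  rw [e1, e2, mul_div_mul_left _ _ Complex.I_ne_zero, h2,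
    sqrt_I_mul _ (by simpa) (by simpa)] at h1
  have n1 := sqrt_ne (lin_ne (-d) c (by omega) Complex.I (by simp))
  have n2 := eta_ne Complex.I (by simp)
  apply mul_right_cancel₀ n1
  apply mul_right_cancel₀ n2
  rw [h1]; ring

theorem base {χ : Matrix (Fin 2) (Fin 2) ℤ → ℂ} (hχ : IsMult χ) (a b d : ℤ)
    (h : a * d - b * 1 = 1) : χ !![a, b; 1, d] = EE (a + d - 3) := by
  have him : 0 < (Complex.I + ((-d : ℤ) : ℂ)).im := by simp
  have h1 := hχ a b 1 d h (Complex.I + ((-d : ℤ) : ℂ)) him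
  have hb : (b : ℂ) = a * d - 1 := by
    have : b = a * d - 1 := by linear_combination -h
    rw [this]; push_cast; ring
  have e2 : ((1 : ℤ) : ℂ) * (Complex.I + ((-d : ℤ) : ℂ)) + d = Complex.I := by push_cast; ring
  have e1 : ((a : ℂ) * (Complex.I + ((-d : ℤ) : ℂ)) + b) / Complex.I = Complex.I + a := by
    rw [div_eq_iff Complex.I_ne_zero, hb]; push_cast
    linear_combination -Complex.I_mul_I
  rw [e2, e1, eta_add, eta_add, EE_3] at h1
  have n2 := eta_ne Complex.I (by simp)
  have h2 : EE a = χ !![a, b; 1, d] * (EE 3 * EE (-d)) := by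
    apply mul_right_cancel₀ n2
    rw [h1]; ring
  rw [← EE_add] at h2
  apply mul_right_cancel₀ (EE_ne (3 + -d))
  rw [← h2, ← EE_add]; congr 1; ring

theorem dvd_cube (m : ℤ) : ∃ k, (2 * m + 1) * ((2 * m + 1) ^ 2 - 1) = 24 * k := by
  have h3 : (3 : ℤ) ∣ m * (m + 1) * (2 * m + 1) := by
    apply Int.dvd_of_emod_eq_zero
    have : m % 3 = 0 ∨ m % 3 = 1 ∨ m % 3 = 2 := by omega
    rcases this with h | h | h <;> simp [Int.mul_emod, Int.add_emod, h]
  have h2 : (2 : ℤ) ∣ m * (m + 1) * (2 * m + 1) := by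
    apply Int.dvd_of_emod_eq_zero
    have : m % 2 = 0 ∨ m % 2 = 1 := by omega
    rcases this with h | h <;> simp [Int.mul_emod, Int.add_emod, h]
  obtain ⟨k, hk⟩ : (6 : ℤ) ∣ m * (m + 1) * (2 * m + 1) := by omega
  exact ⟨k, by linear_combination 4 * hk⟩

theorem recip_pos (m n : ℕ) : ((jacobiSym ((2 * n + 1 : ℕ) : ℤ) (2 * m + 1) : ℤ) : ℂ) =
    ((jacobiSym (-((2 * m + 1 : ℕ) : ℤ)) (2 * n + 1) : ℤ) : ℂ) * EE (12 * (n + m * n)) := by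
  have hn : Odd (2 * n + 1) := ⟨n, rfl⟩
  have hm : Odd (2 * m + 1) := ⟨m, rfl⟩
  have e := EE_12_mul (n + m * n)
  push_cast at e
  rw [e, jacobiSym.neg _ hn, ZMod.χ₄_eq_neg_one_pow (by omega),
    jacobiSym.quadratic_reciprocity hn hm,
    show (2 * n + 1) / 2 = n by omega, show (2 * m + 1) / 2 = m by omega]
  have : ((-1 : ℂ) ^ n) * (-1) ^ n = 1 := by rw [← mul_pow]; simp
  push_cast
  rw [pow_add, mul_comm n m]
  linear_combination -(-1 : ℂ) ^ (m * n) * ((jacobiSym (2 * (m : ℤ) + 1) (2 * n + 1) : ℤ) : ℂ) * this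

theorem recip_neg (m n : ℕ) : ((jacobiSym (-((2 * n + 1 : ℕ) : ℤ)) (2 * m + 1) : ℤ) : ℂ) =
    ((jacobiSym ((2 * m + 1 : ℕ) : ℤ) (2 * n + 1) : ℤ) : ℂ) * EE (12 * (m + m * n)) := by
  have hn : Odd (2 * n + 1) := ⟨n, rfl⟩
  have hm : Odd (2 * m + 1) := ⟨m, rfl⟩
  have e := EE_12_mul (m + m * n)
  push_cast at e
  rw [e, jacobiSym.neg _ hm, ZMod.χ₄_eq_neg_one_pow (by omega),
    jacobiSym.quadratic_reciprocity hn hm,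
    show (2 * n + 1) / 2 = n by omega, show (2 * m + 1) / 2 = m by omega]
  push_cast
  rw [pow_add, mul_comm n m]
  ring

/-- Exponent in the formula for odd `c`. -/
def expo (a b c d : ℤ) : ℤ := (a + d) * c - b * d * (c ^ 2 - 1) - 3 * c

theorem odd_formula {χ : Matrix (Fin 2) (Fin 2) ℤ → ℂ} (hχ : IsMult χ) (m : ℕ) :
    ∀ a b d : ℤ, a * d - b * ((2 * m + 1 : ℕ) : ℤ) = 1 →
      χ !![a, b; ((2 * m + 1 : ℕ) : ℤ), d] =
        ((jacobiSym d (2 * m + 1) : ℤ) : ℂ) * EE (expo a b ((2 * m + 1 : ℕ) : ℤ) d) := by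
  induction m using Nat.strong_induction_on with
  | _ m ih =>
  -- the case of odd `d` with `|d| < c`
  have key : ∀ a b d : ℤ, a * d - b * ((2 * m + 1 : ℕ) : ℤ) = 1 → d % 2 = 1 →
      d < 2 * m + 1 → - (2 * m + 1) < d →
      χ !![a, b; ((2 * m + 1 : ℕ) : ℤ), d] =
        ((jacobiSym d (2 * m + 1) : ℤ) : ℂ) * EE (expo a b ((2 * m + 1 : ℕ) : ℤ) d) := by
    intro a b d h hodd h1 h2
    rcases lt_trichotomy d 0 with hd | hd | hd
    · obtain ⟨n, rfl⟩ : ∃ n : ℕ, d = -((2 * n + 1 : ℕ) : ℤ) := ⟨(-d / 2).toNat, by omega⟩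
      have hS := step_S_neg hχ a b _ _ h (by positivity) hd
      rw [neg_neg, ih n (by omega) (-b) a _ (by linear_combination h)] at hS
      apply mul_right_cancel₀ (EE_ne 3)
      rw [hS, recip_neg, mul_assoc, mul_assoc, ← EE_add, ← EE_add]
      congr 2
      unfold expo
      push_cast at h ⊢
      linear_combination (2 * (m : ℤ) + 1) * (2 * n + 1) * h
    · omega
    · obtain ⟨n, rfl⟩ : ∃ n : ℕ, d = ((2 * n + 1 : ℕ) : ℤ) := ⟨(d / 2).toNat, by omega⟩
      have hS := step_S_pos hχ a b _ _ h (by positivity) hd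
      rw [ih n (by omega) b (-a) _ (by linear_combination h)] at hS
      rw [hS, recip_pos, mul_assoc, mul_assoc, ← EE_add, ← EE_add]
      congr 1
      apply EE_period (-(m + 1) * n)
      unfold expo
      push_cast at h ⊢
      linear_combination -(2 * (m : ℤ) + 1) * (2 * n + 1) * h
  intro a b d h
  rcases Nat.eq_zero_or_pos m with rfl | hm
  · have := base hχ a b d (by simpa using h)
    simp [expo, this]
  · have red : ∃ k : ℤ, (d + k * ((2 * m + 1 : ℕ) : ℤ)) % 2 = 1 ∧
        d + k * ((2 * m + 1 : ℕ) : ℤ) < 2 * m + 1 ∧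
        - (2 * m + 1) < d + k * ((2 * m + 1 : ℕ) : ℤ) := by
      have hr0 : d % ((2 * m + 1 : ℕ) : ℤ) ≠ 0 := by
        intro h0
        obtain ⟨e, he⟩ := Int.dvd_of_emod_eq_zero h0
        have : ((2 * m + 1 : ℕ) : ℤ) ∣ 1 := ⟨a * e - b, by rw [← h, he]; ring⟩
        have := Int.le_of_dvd one_pos this
        omega
      have hr1 := Int.emod_nonneg d (b := ((2 * m + 1 : ℕ) : ℤ)) (by omega)
      have hr2 := Int.emod_lt_of_pos d (b := ((2 * m + 1 : ℕ) : ℤ)) (by omega)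
      have hr3 := Int.emod_add_mul_ediv d ((2 * m + 1 : ℕ) : ℤ)
      generalize d % ((2 * m + 1 : ℕ) : ℤ) = r at *
      generalize d / ((2 * m + 1 : ℕ) : ℤ) = q at *
      rcases Int.emod_two_eq_zero_or_one r with hr | hr
      · refine ⟨-q - 1, ?_⟩
        rw [show d + (-q - 1) * ((2 * m + 1 : ℕ) : ℤ) = r - ((2 * m + 1 : ℕ) : ℤ) by
          linear_combination -hr3]
        omega
      · refine ⟨-q, ?_⟩
        rw [show d + (-q) * ((2 * m + 1 : ℕ) : ℤ) = r by
          linear_combination -hr3]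
        omega
    obtain ⟨k, k1, k2, k3⟩ := red
    have hT := step_T hχ a b _ d k h (by positivity)
    rw [key a (b + k * a) _ (by linear_combination h) k1 k2 k3] at hT
    apply mul_right_cancel₀ (EE_ne k)
    rw [← hT, mul_assoc, ← EE_add]
    congr 1
    · congr 1
      apply jacobiSym.mod_left'
      simp
    · obtain ⟨t, ht⟩ := dvd_cube m
      apply EE_period (-k * (2 * b + k * a) * t)
      unfold expo
      push_cast at h ⊢
      linear_combination (-k * (2 * b + k * a)) * ht
        - k * ((2 * (m : ℤ) + 1) ^ 2 - 1) * h

theorem jac_conv (k : ℤ) (n : ℕ) (hco : Int.gcd 12 (2 * n + 1 : ℕ) = 1) :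
    jacobiSym 12 (2 * n + 1) * jacobiSym (576 * k) (2 * n + 1) =
      ZMod.χ₈ ((2 * n + 1 : ℕ) : ZMod 8) * jacobiSym (24 * k) (2 * n + 1) := by
  have hn : Odd (2 * n + 1) := ⟨n, rfl⟩
  rw [← jacobiSym.at_two hn, ← jacobiSym.mul_left, ← jacobiSym.mul_left,
    show (12 : ℤ) * (576 * k) = 12 ^ 2 * (2 * (24 * k)) by ring, jacobiSym.mul_left (12 ^ 2),
    jacobiSym.sq_one' hco, one_mul]

/-- For `γ' = [[a,b],[c,d]] ∈ Γ₀(576)` (with `c > 0`), the eta multiplier (defined by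
`η(γτ) = χ(γ)√(cτ+d)η(τ)`) satisfies `χ([[a,24b],[c/24,d]]) = (12/d)(c/d)ε_d⁻¹`:
the conjugation of `χ` by scaling by 24 is the character `(12/·)` times the theta
multiplier on `Γ₀(576)`. -/
theorem stmt9 (χ : Matrix (Fin 2) (Fin 2) ℤ → ℂ)
    (hχ : ∀ a b c d : ℤ, a * d - b * c = 1 → ∀ τ : ℂ, 0 < τ.im →
      eta (((a : ℂ) * τ + (b : ℂ)) / ((c : ℂ) * τ + (d : ℂ))) =
        χ !![a, b; c, d] * ((c : ℂ) * τ + (d : ℂ)) ^ ((1 : ℂ)/2) * eta τ) :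
    ∀ a b c d : ℤ, a * d - b * c = 1 → 576 ∣ c → 0 < c →
      χ !![a, 24 * b; c / 24, d] = ((kron 12 d * kron c d : ℤ) : ℂ) * (epsd d)⁻¹ := by
  have hχ' : IsMult χ := hχ
  rintro a b c d h ⟨k, rfl⟩ hc
  have hk : 0 < k := by omega
  rw [show 576 * k / 24 = 24 * k by omega]
  have hdodd : d % 2 = 1 := by
    rcases Int.emod_two_eq_zero_or_one d with h0 | h0
    · obtain ⟨e, rfl⟩ := Int.dvd_of_emod_eq_zero h0
      exfalso
      have : (2 : ℤ) ∣ 1 := ⟨a * e - b * 288 * k, by rw [← h]; ring⟩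
      omega
    · exact h0
  have hcop : IsCoprime (12 : ℤ) d := ⟨-b * 48 * k, a, by linear_combination h⟩
  have hdet : a * d - 24 * b * (24 * k) = 1 := by linear_combination h
  have E18 : EE 18 = -Complex.I := by
    rw [show (18 : ℤ) = 12 + 6 by norm_num, EE_add, EE_12, EE_6]; ring
  rcases lt_trichotomy d 0 with hd | hd | hd
  · obtain ⟨n, rfl⟩ : ∃ n : ℕ, d = -((2 * n + 1 : ℕ) : ℤ) := ⟨(-d / 2).toNat, by omega⟩
    have hco : Int.gcd 12 (2 * n + 1 : ℕ) = 1 := by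
      rw [← Int.isCoprime_iff_gcd_eq_one]; exact (IsCoprime.neg_right_iff _ _).1 hcop
    have hS := step_S_neg hχ' a (24 * b) (24 * k) _ hdet (by omega) hd
    rw [neg_neg, odd_formula hχ' n _ _ _ (by linear_combination hdet)] at hS
    have hJ := jac_conv k n hco
    have hkr : kron 12 (-((2 * n + 1 : ℕ) : ℤ)) * kron (576 * k) (-((2 * n + 1 : ℕ) : ℤ)) =
        ZMod.χ₈ ((2 * n + 1 : ℕ) : ZMod 8) * jacobiSym (24 * k) (2 * n + 1) := by
      rw [← hJ]
      unfold kron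
      rw [if_neg (by omega), if_neg (by omega), Int.natAbs_neg, Int.natAbs_natCast]; ring
    rw [hkr]
    apply mul_right_cancel₀ (EE_ne 3)
    rw [hS]
    have e1 : EE (expo (-(24 * b)) a ((2 * n + 1 : ℕ) : ℤ) (24 * k)) =
        EE (-6 * n - 6) * EE 3 := by
      rw [← EE_add]
      apply EE_period ((-b + k) * (2 * n + 1) - a * k * ((2 * n + 1) ^ 2 - 1))
      unfold expo; push_cast; ring
    rw [e1]
    suffices hh : EE (-6 * n - 6) = ((ZMod.χ₈ ((2 * n + 1 : ℕ) : ZMod 8) : ℤ) : ℂ) *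
        (epsd (-((2 * n + 1 : ℕ) : ℤ)))⁻¹ by
      rw [hh]; push_cast; ring
    have hc4 : n % 4 = 0 ∨ n % 4 = 1 ∨ n % 4 = 2 ∨ n % 4 = 3 := by omega
    have hq : (n : ℤ) = 4 * (n / 4 : ℕ) + (n % 4 : ℕ) := by omega
    rw [ZMod.χ₈_nat_eq_if_mod_eight]
    unfold epsd
    rcases hc4 with h4 | h4 | h4 | h4 <;> rw [h4] at hq
    · rw [EE_period (n := 18) (-(n / 4 : ℕ) - 1) (by omega), if_neg (by omega), if_pos (by omega),
        if_neg (by omega), E18]; simp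
    · rw [EE_period (n := 12) (-(n / 4 : ℕ) - 1) (by omega), if_neg (by omega), if_neg (by omega),
        if_pos (by omega), EE_12]; simp
    · rw [EE_period (n := 6) (-(n / 4 : ℕ) - 1) (by omega), if_neg (by omega), if_neg (by omega),
        if_neg (by omega), EE_6]; simp
    · rw [EE_period (n := 0) (-(n / 4 : ℕ) - 1) (by omega), if_neg (by omega), if_pos (by omega),
        if_pos (by omega), EE_zero]; simp
  · omega
  · obtain ⟨n, rfl⟩ : ∃ n : ℕ, d = ((2 * n + 1 : ℕ) : ℤ) := ⟨(d / 2).toNat, by omega⟩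
    have hn : Odd (2 * n + 1) := ⟨n, rfl⟩
    have hco : Int.gcd 12 (2 * n + 1 : ℕ) = 1 := by
      rw [← Int.isCoprime_iff_gcd_eq_one]; exact hcop
    have hS := step_S_pos hχ' a (24 * b) (24 * k) _ hdet (by omega) hd
    rw [odd_formula hχ' n _ _ _ (by linear_combination hdet), jacobiSym.neg _ hn,
      ZMod.χ₄_eq_neg_one_pow (by omega), show (2 * n + 1) / 2 = n by omega] at hS
    have hJ := jac_conv k n hco
    have hkr : kron 12 ((2 * n + 1 : ℕ) : ℤ) * kron (576 * k) ((2 * n + 1 : ℕ) : ℤ) =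
        ZMod.χ₈ ((2 * n + 1 : ℕ) : ZMod 8) * jacobiSym (24 * k) (2 * n + 1) := by
      rw [← hJ]
      unfold kron
      rw [if_neg (by omega), if_neg (by omega), Int.natAbs_natCast]; ring
    rw [hkr, hS]
    have e1 : (-1) ^ n * EE (expo (24 * b) (-a) ((2 * n + 1 : ℕ) : ℤ) (-(24 * k))) * EE 3 =
        EE (6 * n) := by
      rw [← EE_12_mul, ← EE_add, ← EE_add]
      apply EE_period ((b - k) * (2 * n + 1) - a * k * ((2 * n + 1) ^ 2 - 1))
      unfold expo; push_cast; ring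
    suffices hh : EE (6 * n) = ((ZMod.χ₈ ((2 * n + 1 : ℕ) : ZMod 8) : ℤ) : ℂ) *
        (epsd ((2 * n + 1 : ℕ) : ℤ))⁻¹ by
      rw [hh] at e1
      push_cast at e1 ⊢
      linear_combination ((jacobiSym (24 * k) (2 * n + 1) : ℤ) : ℂ) * e1
    have hc4 : n % 4 = 0 ∨ n % 4 = 1 ∨ n % 4 = 2 ∨ n % 4 = 3 := by omega
    have hq : (n : ℤ) = 4 * (n / 4 : ℕ) + (n % 4 : ℕ) := by omega
    rw [ZMod.χ₈_nat_eq_if_mod_eight]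
    unfold epsd
    rcases hc4 with h4 | h4 | h4 | h4 <;> rw [h4] at hq
    · rw [EE_period (n := 0) (n / 4 : ℕ) (by omega), if_neg (by omega), if_pos (by omega),
        if_pos (by omega), EE_zero]; simp
    · rw [EE_period (n := 6) (n / 4 : ℕ) (by omega), if_neg (by omega), if_neg (by omega),
        if_neg (by omega), EE_6]; simp
    · rw [EE_period (n := 12) (n / 4 : ℕ) (by omega), if_neg (by omega), if_neg (by omega),
        if_pos (by omega), EE_12]; simp
    · rw [EE_period (n := 18) (n / 4 : ℕ) (by omega), if_neg (by omega), if_pos (by omega),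
        if_neg (by omega), E18]; simp
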